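/- Fix an integer N ≥ 1. Let P_m, for m = 0, …, N, be the Legendre polynomials, let -1 = x_0 < x_1 < … < x_N = 1 be the N+1 roots of (1-x²)P_N'(x), and let w_i = 2/(N(N+1)P_N(x_i)²). Then for every choice of real coefficients c_0, …, c_N and the polynomial u(x) = Σ_{m=0}^N c_m P_m(x), one has Σ_{i=0}^N u(x_i)² w_i ≥ (N/(2N+1)) Σ_{m=0}^N c_m² (Σ_{i=0}^N P_m(x_i)² w_i). -/

import Mathlib

open Finset

/-- The Legendre polynomial of degree `m`, via the Rodrigues formula
`P_m(x) = (1/(2^m m!)) (d/dx)^m (x²-1)^m`. -/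
noncomputable def legendreP (m : ℕ) (x : ℝ) : ℝ :=
  (1 / ((2 : ℝ) ^ m * m.factorial)) * iteratedDeriv m (fun y => (y ^ 2 - 1) ^ m) x

open Polynomial in
/-- The unnormalised Rodrigues polynomial `(d/dX)^m (X² - 1)^m`. -/
noncomputable def rodriguesPoly (m : ℕ) : ℝ[X] :=
  derivative^[m] ((X ^ 2 - 1) ^ m)

open Polynomial in
theorem iteratedDeriv_polynomial_eval (p : ℝ[X]) (m : ℕ) :
    iteratedDeriv m (fun y => p.eval y) = fun y => (derivative^[m] p).eval y := by
  induction m with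
  | zero => simp
  | succ m ih =>
    ext y
    rw [iteratedDeriv_succ, ih, Function.iterate_succ_apply', Polynomial.deriv]

theorem legendreP_eq_eval (m : ℕ) (x : ℝ) :
    legendreP m x = 1 / ((2 : ℝ) ^ m * m.factorial) * (rodriguesPoly m).eval x := by
  have h := congrFun (iteratedDeriv_polynomial_eval ((Polynomial.X ^ 2 - 1) ^ m) m) x
  simp only [Polynomial.eval_pow, Polynomial.eval_sub, Polynomial.eval_X,
    Polynomial.eval_one] at h
  rw [legendreP, h, rodriguesPoly]

theorem deriv_legendreP (m : ℕ) (x : ℝ) :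
    deriv (legendreP m) x =
      1 / ((2 : ℝ) ^ m * m.factorial) * (rodriguesPoly m).derivative.eval x := by
  rw [funext (legendreP_eq_eval m), deriv_const_mul_field, Polynomial.deriv]

open Polynomial in
theorem iterate_derivative_X_mul (p : ℝ[X]) (n : ℕ) :
    derivative^[n] (X * p) = X * derivative^[n] p + (n : ℝ[X]) * derivative^[n - 1] p := by
  rw [mul_comm, iterate_derivative_mul_X, nsmul_eq_mul, mul_comm X]

open Polynomial in
theorem derivative_sq_sub_one_pow_succ (m : ℕ) :
    derivative ((X ^ 2 - 1 : ℝ[X]) ^ (m + 1)) =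
      ((2 * (m + 1) : ℕ) : ℝ[X]) * (X * (X ^ 2 - 1) ^ m) := by
  rw [derivative_pow_succ]
  simp only [derivative_sub, derivative_X_sq, derivative_one, map_add, map_natCast, map_one,
    C_ofNat]
  push_cast
  ring

open Polynomial in
theorem rodriguesPoly_succ (m : ℕ) :
    rodriguesPoly (m + 1) =
      ((2 * (m + 1) : ℕ) : ℝ[X]) * derivative^[m] (X * (X ^ 2 - 1) ^ m) := by
  rw [rodriguesPoly, Function.iterate_succ_apply, derivative_sq_sub_one_pow_succ,
    iterate_derivative_natCast_mul]

open Polynomial in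
theorem derivative_rodriguesPoly_succ (m : ℕ) :
    derivative (rodriguesPoly (m + 1)) =
      (2 * (m + 1) : ℝ[X]) *
        (X * derivative (rodriguesPoly m) + (m + 1 : ℝ[X]) * rodriguesPoly m) := by
  rw [rodriguesPoly_succ, derivative_natCast_mul,
    ← Function.iterate_succ_apply' (f := derivative), iterate_derivative_X_mul,
    Function.iterate_succ_apply', Nat.succ_sub_one, rodriguesPoly]
  push_cast
  ring

open Polynomial in
/-- The result of applying `(d/dX)^m` to `(X² - 1) ((X² - 1)^m)' = 2 m X (X² - 1)^m`. -/
theorem sub_one_mul_derivative_rodriguesPoly (m : ℕ) :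
    (X ^ 2 - 1) * derivative (rodriguesPoly m) =
      (m * (m + 1) : ℝ[X]) * derivative^[m - 1] ((X ^ 2 - 1) ^ m) := by
  rcases m with _ | k
  · simp [rodriguesPoly]
  set f : ℝ[X] := (X ^ 2 - 1) ^ (k + 1) with hf
  have h : X * (X * derivative f) - derivative f = ((2 * (k + 1) : ℕ) : ℝ[X]) * (X * f) := by
    rw [hf, derivative_sq_sub_one_pow_succ]
    ring
  have h' := congrArg (derivative^[k + 1]) h
  have hk : (k : ℝ[X]) * derivative^[k - 1 + 1] f = k * derivative^[k] f := by
    rcases k with _ | k <;> simp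
  rw [iterate_derivative_sub, iterate_derivative_natCast_mul] at h'
  simp only [iterate_derivative_X_mul, Nat.add_sub_cancel, ← Function.iterate_succ_apply,
    Nat.succ_eq_add_one] at h'
  rw [rodriguesPoly, ← hf, ← Function.iterate_succ_apply' (f := derivative),
    Nat.succ_eq_add_one, Nat.add_sub_cancel]
  push_cast at h' ⊢
  linear_combination h' - (k + 1) * hk

open Polynomial in
theorem rodriguesPoly_succ_eq (m : ℕ) :
    (m + 1 : ℝ[X]) * rodriguesPoly (m + 1) =
      (2 * (m + 1) : ℝ[X]) * ((m + 1 : ℝ[X]) * X * rodriguesPoly m -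
        (1 - X ^ 2) * derivative (rodriguesPoly m)) := by
  have h := sub_one_mul_derivative_rodriguesPoly m
  rw [rodriguesPoly_succ, iterate_derivative_X_mul, ← rodriguesPoly]
  push_cast
  linear_combination (-(2 * (m + 1) : ℝ[X])) * h

theorem deriv_legendreP_succ (m : ℕ) (x : ℝ) :
    deriv (legendreP (m + 1)) x = x * deriv (legendreP m) x + (m + 1) * legendreP m x := by
  have h := congrArg (Polynomial.eval x) (derivative_rodriguesPoly_succ m)
  simp at h
  have hm : (m.factorial : ℝ) ≠ 0 := by positivity
  rw [deriv_legendreP, deriv_legendreP, legendreP_eq_eval, h, Nat.factorial_succ, pow_succ]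
  push_cast
  field_simp

theorem legendreP_succ (m : ℕ) (x : ℝ) :
    (m + 1) * legendreP (m + 1) x =
      (m + 1) * x * legendreP m x - (1 - x ^ 2) * deriv (legendreP m) x := by
  have h := congrArg (Polynomial.eval x) (rodriguesPoly_succ_eq m)
  simp at h
  have hm : (m.factorial : ℝ) ≠ 0 := by positivity
  rw [deriv_legendreP, legendreP_eq_eval, legendreP_eq_eval, Nat.factorial_succ, pow_succ]
  push_cast
  field_simp
  refine mul_left_cancel₀ (by positivity : (m + 1 : ℝ) ≠ 0) ?_
  linear_combination h

theorem legendreP_zero (x : ℝ) : legendreP 0 x = 1 := by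
  simp [legendreP]

theorem deriv_legendreP_zero (x : ℝ) : deriv (legendreP 0) x = 0 := by
  rw [funext legendreP_zero]
  simp

/-- The Christoffel–Darboux formula, written with `P_N` and `P_N'` only. -/
theorem christoffel_darboux_legendreP (N : ℕ) (x y : ℝ) :
    (x - y) * ∑ m ∈ range N, (2 * m + 1) * (legendreP m x * legendreP m y) =
      legendreP N x * (N * y * legendreP N y + (1 - y ^ 2) * deriv (legendreP N) y) -
        legendreP N y * (N * x * legendreP N x + (1 - x ^ 2) * deriv (legendreP N) x) := by
  induction N with
  | zero => simp [deriv_legendreP_zero]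
  | succ N ih =>
    rw [sum_range_succ, mul_add, ih, deriv_legendreP_succ, deriv_legendreP_succ]
    have hx := legendreP_succ N x
    have hy := legendreP_succ N y
    push_cast
    have e : ∀ z, (N + 1) * z * legendreP (N + 1) z +
        (1 - z ^ 2) * (z * deriv (legendreP N) z + (N + 1) * legendreP N z) =
        (N + 1) * legendreP N z := fun z => by
      linear_combination z * legendreP_succ N z
    rw [e, e]
    linear_combination legendreP N x * hy - legendreP N y * hx

/-- The sum of squares `∑_{m<N} (2m+1) P_m²` in terms of `P_N` and `P_N'`. -/
theorem sum_sq_legendreP (N : ℕ) (x : ℝ) :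
    ∑ m ∈ range N, (2 * m + 1) * legendreP m x ^ 2 =
      N ^ 2 * legendreP N x ^ 2 + (1 - x ^ 2) * deriv (legendreP N) x ^ 2 := by
  induction N with
  | zero => simp [deriv_legendreP_zero]
  | succ N ih =>
    rw [sum_range_succ, ih, deriv_legendreP_succ]
    push_cast
    rw [← mul_pow _ (legendreP (N + 1) x), legendreP_succ]
    ring

/-- The reciprocals of the squared discrete norms of `P_0, …, P_N` on the Legendre–Gauss–Lobatto
nodes. -/
noncomputable def lobattoInvNormSq (N m : ℕ) : ℝ :=
  if m < N then (2 * m + 1) / 2 else N / 2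

theorem lobattoInvNormSq_pos {N : ℕ} (hN : 1 ≤ N) (m : ℕ) : 0 < lobattoInvNormSq N m := by
  have : (0 : ℝ) < N := by exact_mod_cast hN
  unfold lobattoInvNormSq
  split_ifs <;> positivity

theorem sum_lobattoInvNormSq_mul (N : ℕ) (f : ℕ → ℝ) :
    ∑ m : Fin (N + 1), lobattoInvNormSq N m * f m =
      ((∑ m ∈ range N, (2 * m + 1) * f m) + N * f N) / 2 := by
  rw [Fin.sum_univ_eq_sum_range (fun m => lobattoInvNormSq N m * f m), sum_range_succ,
    sum_congr rfl (g := fun m => (2 * m + 1) * f m / 2), ← sum_div]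
  · simp [lobattoInvNormSq]
    ring
  · intro m hm
    simp [lobattoInvNormSq, mem_range.mp hm]
    ring

theorem sum_lobattoInvNormSq_of_ne {N : ℕ} {x y : ℝ} (hxy : x ≠ y)
    (hx : (1 - x ^ 2) * deriv (legendreP N) x = 0)
    (hy : (1 - y ^ 2) * deriv (legendreP N) y = 0) :
    ∑ m : Fin (N + 1), lobattoInvNormSq N m * (legendreP m x * legendreP m y) = 0 := by
  rw [sum_lobattoInvNormSq_mul N (fun m => legendreP m x * legendreP m y)]
  have h := christoffel_darboux_legendreP N x y
  rw [hx, hy] at h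
  apply mul_left_cancel₀ (sub_ne_zero.mpr hxy)
  linear_combination h / 2

theorem sum_lobattoInvNormSq_self {N : ℕ} {x : ℝ}
    (hx : (1 - x ^ 2) * deriv (legendreP N) x = 0) :
    ∑ m : Fin (N + 1), lobattoInvNormSq N m * (legendreP m x * legendreP m x) =
      N * (N + 1) * legendreP N x ^ 2 / 2 := by
  rw [sum_lobattoInvNormSq_mul N (fun m => legendreP m x * legendreP m x)]
  have h := sum_sq_legendreP N x
  simp only [pow_two (legendreP _ _)] at h
  rw [h]
  linear_combination deriv (legendreP N) x * hx / 2

/-- Discrete orthogonality of `P_0, …, P_N` on the Legendre–Gauss–Lobatto nodes. -/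
theorem legendreP_discrete_orthogonal {N : ℕ} (hN : 1 ≤ N) {x : Fin (N + 1) → ℝ}
    (hx : Function.Injective x)
    (hroot : ∀ i, (1 - x i ^ 2) * deriv (legendreP N) (x i) = 0)
    {w : Fin (N + 1) → ℝ}
    (hw : ∀ i, w i = 2 / ((N : ℝ) * (N + 1) * legendreP N (x i) ^ 2))
    {m n : Fin (N + 1)} (hmn : m ≠ n) :
    ∑ i, legendreP m (x i) * legendreP n (x i) * w i = 0 := by
  let V : Matrix (Fin (N + 1)) (Fin (N + 1)) ℝ := .of fun i m => legendreP m (x i)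
  let B : Matrix (Fin (N + 1)) (Fin (N + 1)) ℝ :=
    .of fun m i => lobattoInvNormSq N m * legendreP m (x i) * w i
  have hVB : V * B = 1 := by
    ext i j
    have e : (V * B) i j = (∑ m : Fin (N + 1),
        lobattoInvNormSq N m * (legendreP m (x i) * legendreP m (x j))) * w j := by
      rw [Matrix.mul_apply, sum_mul]
      exact sum_congr rfl fun m _ => by simp only [V, B, Matrix.of_apply]; ring
    rw [e]
    rcases eq_or_ne i j with rfl | hij
    · have hpos : 0 < ∑ m : Fin (N + 1),
          lobattoInvNormSq N m * (legendreP m (x i) * legendreP m (x i)) := by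
        refine sum_pos' (fun m _ => mul_nonneg (lobattoInvNormSq_pos hN m).le
          (mul_self_nonneg _)) ⟨0, mem_univ _, ?_⟩
        simpa [legendreP_zero] using lobattoInvNormSq_pos hN 0
      rw [sum_lobattoInvNormSq_self (hroot i)] at hpos ⊢
      rw [hw, Matrix.one_apply_eq, ← inv_div, inv_mul_cancel₀]
      · exact (div_pos two_pos (by linarith)).ne'
    · rw [sum_lobattoInvNormSq_of_ne (hx.ne hij) (hroot i) (hroot j), zero_mul,
        Matrix.one_apply_ne hij]
  have h := Matrix.ext_iff.mpr (mul_eq_one_comm.mp hVB) m n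
  rw [Matrix.mul_apply, Matrix.one_apply_ne hmn] at h
  refine (mul_eq_zero.mp ?_).resolve_left (lobattoInvNormSq_pos hN m).ne'
  rw [← h, mul_sum]
  exact sum_congr rfl fun i _ => by simp only [V, B, Matrix.of_apply]; ring

/-- Parseval's identity for a weighted discrete inner product. -/
theorem sum_sq_mul_of_orthogonal {ι κ : Type*} [Fintype ι] [Fintype κ] {p : κ → ι → ℝ}
    {w : ι → ℝ} (h : ∀ m n, m ≠ n → ∑ i, p m i * p n i * w i = 0) (c : κ → ℝ) :
    ∑ i, (∑ m, c m * p m i) ^ 2 * w i = ∑ m, c m ^ 2 * ∑ i, p m i ^ 2 * w i := by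
  calc ∑ i, (∑ m, c m * p m i) ^ 2 * w i
      = ∑ m, ∑ n, c m * c n * ∑ i, p m i * p n i * w i := by
        simp_rw [pow_two, sum_mul_sum, sum_mul, mul_sum]
        rw [sum_comm]
        refine sum_congr rfl fun m _ => ?_
        rw [sum_comm]
        exact sum_congr rfl fun n _ => sum_congr rfl fun i _ => by ring
    _ = ∑ m, c m ^ 2 * ∑ i, p m i ^ 2 * w i := by
        refine sum_congr rfl fun m _ => ?_
        rw [Fintype.sum_eq_single m fun n hn => by rw [h m n hn.symm, mul_zero]]
        simp_rw [pow_two]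

/-- **Lower bound of the discrete norm in terms of the Legendre coefficients**
(inequality (22) of the paper): on the Legendre–Gauss–Lobatto nodes
`-1 = x_0 < … < x_N = 1` (roots of `(1-x²)P_N'(x)`) with weights
`w_i = 2/(N(N+1)P_N(x_i)²)`, for `u = Σ_{m=0}^N c_m P_m`,
`Σ_i u(x_i)² w_i ≥ (N/(2N+1)) Σ_m c_m² (Σ_i P_m(x_i)² w_i)`. -/
theorem discrete_norm_legendre_coeff_bound (N : ℕ) (hN : 1 ≤ N)
    (x : Fin (N + 1) → ℝ) (hx : StrictMono x)
    (hx0 : x 0 = -1) (hxN : x (Fin.last N) = 1)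
    (hroot : ∀ i, (1 - x i ^ 2) * deriv (legendreP N) (x i) = 0)
    (w : Fin (N + 1) → ℝ)
    (hw : ∀ i, w i = 2 / ((N : ℝ) * (N + 1) * legendreP N (x i) ^ 2))
    (c : Fin (N + 1) → ℝ) :
    ∑ i : Fin (N + 1), (∑ m : Fin (N + 1), c m * legendreP m (x i)) ^ 2 * w i ≥
      ((N : ℝ) / (2 * N + 1)) *
        ∑ m : Fin (N + 1), c m ^ 2 * (∑ i : Fin (N + 1), legendreP m (x i) ^ 2 * w i) := by
  rw [sum_sq_mul_of_orthogonal (p := fun (m : Fin (N + 1)) i => legendreP m (x i))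
    (fun m n hmn => legendreP_discrete_orthogonal hN hx.injective hroot hw hmn) c]
  refine mul_le_of_le_one_left ?_ ?_
  · refine sum_nonneg fun m _ => mul_nonneg (sq_nonneg _) (sum_nonneg fun i _ => ?_)
    rw [hw]
    positivity
  · rw [div_le_one (by positivity)]
    linarith [(Nat.cast_nonneg N : (0 : ℝ) ≤ N)]
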